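/- arXiv:1804.07904 — 2 statements merged into one kernel-verified Lean document; each statement's English description precedes it below -/
import Mathlib

section
/- Let A = F_q[T], K/F a degree r extension, and O ⊂ O' two A-orders in K with conductor c = {c ∈ K : c·O' ⊆ O} and refined index (b₁, …, b_{r-1}) with b₁ | ⋯ | b_{r-1}. Then c ∩ A = b_{r-1}. -/
open Polynomial

/-- For `A`-orders `O ⊆ O'` in a degree-`r` extension `K/F` with refined index
`(b₁, …, b_{r-1})`, `b₁ ∣ ⋯ ∣ b_{r-1}`, the conductor `c = {c ∈ K : c·O' ⊆ O}` satisfies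
`c ∩ A = b_{r-1}`. -/
theorem stmt1 (Fq : Type*) [Field Fq] [Fintype Fq] (r : ℕ) (hr : 2 ≤ r)
    (K : Type*) [Field K] [Algebra (RatFunc Fq) K] [Algebra (Polynomial Fq) K]
    [IsScalarTower (Polynomial Fq) (RatFunc Fq) K]
    (hK : Module.finrank (RatFunc Fq) K = r)
    (O O' : Subalgebra (Polynomial Fq) K)
    (hOO' : O ≤ O')
    (hOfg : (Subalgebra.toSubmodule O).FG) (hO'fg : (Subalgebra.toSubmodule O').FG)
    (hOspan : Submodule.span (RatFunc Fq) (O : Set K) = ⊤)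
    (hO'span : Submodule.span (RatFunc Fq) (O' : Set K) = ⊤)
    (b : Fin (r - 1) → Ideal (Polynomial Fq))
    (hb0 : ∀ i, b i ≠ ⊥) (hbchain : ∀ i j : Fin (r - 1), i ≤ j → b i ∣ b j)
    (hiso : Nonempty
      (((Subalgebra.toSubmodule O' : Submodule (Polynomial Fq) K) ⧸
          (Subalgebra.toSubmodule O).comap (Subalgebra.toSubmodule O').subtype) ≃ₗ[Polynomial Fq]
        ((i : Fin (r - 1)) → Polynomial Fq ⧸ b i))) :
    ∀ a : Polynomial Fq,
      (∀ x ∈ O', algebraMap (Polynomial Fq) K a * x ∈ O) ↔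
        a ∈ b ⟨r - 2, by omega⟩ := by
  intro a
  obtain ⟨e⟩ := hiso
  constructor
  · intro h
    have key : ∀ z : ((i : Fin (r - 1)) → Polynomial Fq ⧸ b i), a • z = 0 := by
      intro z
      obtain ⟨y, rfl⟩ := e.surjective z
      obtain ⟨x, rfl⟩ := Submodule.Quotient.mk_surjective _ y
      rw [← map_smul, ← Submodule.Quotient.mk_smul]
      have hx : (Submodule.Quotient.mk (a • x) :
          ((Subalgebra.toSubmodule O' : Submodule (Polynomial Fq) K) ⧸
          (Subalgebra.toSubmodule O).comap (Subalgebra.toSubmodule O').subtype)) = 0 := by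
        rw [Submodule.Quotient.mk_eq_zero, Submodule.mem_comap]
        have := h x.1 x.2
        rw [← Algebra.smul_def] at this
        exact this
      rw [hx, map_zero]
    have h1 := congrFun (key (fun i => Ideal.Quotient.mk (b i) 1)) ⟨r - 2, by omega⟩
    rw [← Ideal.Quotient.eq_zero_iff_mem]
    have h2 : Ideal.Quotient.mk (b ⟨r - 2, by omega⟩) (a • (1 : Polynomial Fq)) = 0 := h1
    simpa using h2
  · intro ha x hx
    have key : ∀ z : ((i : Fin (r - 1)) → Polynomial Fq ⧸ b i), a • z = 0 := by
      intro z
      funext i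
      obtain ⟨p, hp⟩ := Ideal.Quotient.mk_surjective (z i)
      have hai : a ∈ b i := by
        refine Ideal.le_of_dvd (hbchain i ⟨r - 2, by omega⟩ ?_) ha
        have := i.2
        rw [Fin.le_def]
        show i.1 ≤ r - 2
        omega
      have h3 : Ideal.Quotient.mk (b i) (a • p) = 0 := by
        rw [Ideal.Quotient.eq_zero_iff_mem, smul_eq_mul]
        exact Ideal.mul_mem_right _ _ hai
      show a • z i = 0
      rw [← hp]
      exact h3
    have h4 := key (e (Submodule.Quotient.mk ⟨x, hx⟩))
    rw [← map_smul, LinearEquiv.map_eq_zero_iff, ← Submodule.Quotient.mk_smul,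
      Submodule.Quotient.mk_eq_zero, Submodule.mem_comap] at h4
    rw [← Algebra.smul_def]
    exact h4
end

section
/- Let φ be a Drinfeld A-module of rank r over F_p with Frobenius π = τ^d ∈ E = End_{F_p}(φ), and suppose A[π] and E are A-orders in a degree r field extension K of F with refined index (b₁,…,b_{r-1}), b₁ | ⋯ | b_{r-1}, for A[π] ⊂ E. Let n ∈ A be nonzero and coprime to p. Then π acts as a scalar (i.e. as φ_c for some c ∈ A) on the n-torsion φ[n] if and only if n divides b₁. -/
open Polynomial

/-- Twisted polynomial multiplication on `L{τ}` (`τ·c = c^q·τ`), modelled on `Polynomial L`. -/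
noncomputable def tmul {L : Type*} [CommSemiring L] (q : ℕ) (f g : Polynomial L) : Polynomial L :=
  f.sum fun i a => g.sum fun j b => Polynomial.monomial (i + j) (a * b ^ q ^ i)

/-- Evaluation of a twisted polynomial `Σ aᵢ τ^i ∈ L{τ}` at a point `x` of an `L`-algebra `M`,
namely `Σ aᵢ x^{q^i}`. -/
noncomputable def teval {L M : Type*} [CommSemiring L] [CommSemiring M] [Algebra L M]
    (q : ℕ) (f : Polynomial L) (x : M) : M :=
  f.sum fun i a => algebraMap L M a * x ^ q ^ i

set_option linter.unusedSectionVars false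
set_option linter.style.haveILetI false


theorem rank_aux {A S M : Type*} [CommRing A] [IsDomain A] [CommRing S] [IsDomain S]
    [Algebra A S] [FaithfulSMul A S] [Module.Finite A S] [Module.Free A S] [AddCommGroup M]
    [Module A M] [Module S M] [IsScalarTower A S M] [Module.Finite A M] [Module.Free A M]
    (k : ℕ) (hk : ∀ l < k, l * Module.finrank A S < Module.finrank A M) :
    ∃ y : Fin k → M, LinearIndependent S y := by
  classical
  induction k with
  | zero => exact ⟨Fin.elim0, linearIndependent_empty_type⟩
  | succ k ih =>
    obtain ⟨y, hy⟩ := ih (fun l hl => hk l (by omega))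
    by_cases hx : ∃ x : M, ∀ (c : S), c • x ∈ Submodule.span S (Set.range y) → c = 0
    · obtain ⟨x, hx⟩ := hx
      refine ⟨Fin.cons x y, LinearIndependent.finCons' x y hy ?_⟩
      intro c z hz hcz
      apply hx
      have : c • x = - (z : M) := eq_neg_of_add_eq_zero_left hcz
      rw [this]
      exact Submodule.neg_mem _ hz
    · exfalso
      push Not at hx
      let B := Module.finBasis A M
      let b := Module.finBasis A S
      have h1 : ∀ t, ∃ a : A, a ≠ 0 ∧ a • B t ∈ Submodule.span S (Set.range y) := by
        intro t
        obtain ⟨c, hc, hc0⟩ := hx (B t)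
        obtain ⟨a, ha, d, hd⟩ := ((Algebra.IsIntegral.isIntegral (R := A) c).isAlgebraic).exists_nonzero_dvd
          (mem_nonZeroDivisors_of_ne_zero hc0)
        refine ⟨a, ha, ?_⟩
        rw [← algebraMap_smul S a (B t), hd, mul_comm, mul_smul]
        exact Submodule.smul_mem _ _ hc
      choose a ha hat using h1
      have hli : LinearIndependent A (fun t => a t • B t) := by
        rw [linearIndependent_iff']
        intro s g hg i hi
        have := linearIndependent_iff'.mp B.linearIndependent s (fun i => g i * a i)
          (by simpa only [mul_smul] using hg) i hi
        exact (mul_eq_zero.mp this).resolve_right (ha i)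
      let w : Fin (Module.finrank A S) × Fin k → M := fun x => b x.1 • y x.2
      have hsp : ∀ x ∈ Submodule.span S (Set.range y), x ∈ Submodule.span A (Set.range w) := by
        intro x hx
        obtain ⟨c, rfl⟩ := (Submodule.mem_span_range_iff_exists_fun S).mp hx
        apply Submodule.sum_mem
        intro i _
        rw [← b.sum_repr (c i), Finset.sum_smul]
        apply Submodule.sum_mem
        intro l _
        rw [smul_assoc]
        exact Submodule.smul_mem _ _ (Submodule.subset_span ⟨(l, i), rfl⟩)
      have hfin : Fintype (Set.range w) := Fintype.ofFinite _
      have := linearIndependent_le_span_aux' _ hli (Set.range w)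
        (by rintro _ ⟨t, rfl⟩; exact hsp _ (hat t))
      have h2 := this.trans (Fintype.card_range_le w)
      simp only [Fintype.card_fin, Fintype.card_prod] at h2
      have := hk k (by omega)
      rw [mul_comm] at this
      omega

theorem card_quot_smul {A M : Type*} [CommRing A] [IsDomain A] [AddCommGroup M] [Module A M]
    [Module.Finite A M] [Module.Free A M] (n : A) :
    Nat.card (M ⧸ (LinearMap.range (LinearMap.lsmul A M n))) =
      Nat.card (A ⧸ Ideal.span {n}) ^ Module.finrank A M := by
  let B := Module.finBasis A M
  let f : M →ₗ[A] (Fin (Module.finrank A M) → A ⧸ Ideal.span {n}) :=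
    (LinearMap.compLeft (Submodule.mkQ (Ideal.span {n})) _).comp B.equivFun.toLinearMap
  have hf : Function.Surjective f := by
    intro g
    choose v hv using fun i => Submodule.mkQ_surjective (Ideal.span {n}) (g i)
    refine ⟨B.equivFun.symm v, ?_⟩
    ext i
    simp only [f, LinearMap.comp_apply, LinearMap.compLeft_apply, Function.comp_apply,
      LinearEquiv.coe_coe, LinearEquiv.apply_symm_apply]
    exact hv i
  have hk : LinearMap.ker f = LinearMap.range (LinearMap.lsmul A M n) := by
    ext x
    rw [LinearMap.mem_ker, LinearMap.mem_range]
    constructor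
    · intro h
      have h1 : ∀ i, ∃ c, B.repr x i = n * c := by
        intro i
        have := congrFun h i
        simp only [f, LinearMap.comp_apply, LinearMap.compLeft_apply, Function.comp_apply] at this
        have := (Submodule.Quotient.mk_eq_zero _).mp this
        rw [Ideal.mem_span_singleton] at this
        exact this
      choose c hc using h1
      refine ⟨B.equivFun.symm c, ?_⟩
      apply B.equivFun.injective
      ext i
      simp only [LinearMap.lsmul_apply, map_smul, LinearEquiv.apply_symm_apply, Pi.smul_apply,
        smul_eq_mul, Module.Basis.equivFun_apply, hc]
    · rintro ⟨y, rfl⟩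
      ext i
      simp only [f, LinearMap.comp_apply, LinearMap.compLeft_apply, Function.comp_apply]
      refine (Submodule.Quotient.mk_eq_zero _).mpr ?_
      rw [Ideal.mem_span_singleton]
      simp
  rw [← hk, Nat.card_congr (f.quotKerEquivOfSurjective hf).toEquiv, Nat.card_fun]
  simp

theorem card_quot_X {A H : Type*} [CommRing A] [IsDomain A] [CommRing H]
    [Nontrivial H] [Algebra A H]
    [Module.Finite A H] [Module.Free A H] (n : A) [Finite (A ⧸ Ideal.span {n})]
    (hdiv : ∀ (a : A) (h : H), n • h = algebraMap A H a → n ∣ a) :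
    Nat.card (H ⧸ ((1 : Submodule A H) ⊔ LinearMap.range (LinearMap.lsmul A H n))) =
      Nat.card (A ⧸ Ideal.span {n}) ^ (Module.finrank A H - 1) := by
  set N := LinearMap.range (LinearMap.lsmul A H n) with hN
  have h1 := Submodule.card_quotient_mul_card_quotient 
    ((1 : Submodule A H) ⊔ N) N le_sup_right
  have hcard := card_quot_smul (M := H) n
  let f : A →ₗ[A] (H ⧸ N) := N.mkQ.comp (Algebra.linearMap A H)
  have hk : LinearMap.ker f = Ideal.span {n} := by
    ext a
    rw [LinearMap.mem_ker]
    simp only [f, LinearMap.comp_apply, Submodule.mkQ_apply, Submodule.Quotient.mk_eq_zero,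
      Ideal.mem_span_singleton]
    constructor
    · rintro ⟨h, hh⟩
      exact hdiv a h hh
    · rintro ⟨c, rfl⟩
      exact ⟨algebraMap A H c, by simp [Algebra.smul_def]⟩
  have h2 : Submodule.map N.mkQ ((1 : Submodule A H) ⊔ N) = LinearMap.range f := by
    rw [Submodule.map_sup]
    have : Submodule.map N.mkQ N = ⊥ := by simp
    rw [this, sup_bot_eq, LinearMap.range_comp, Submodule.one_eq_range]
  rw [h2, ← Nat.card_congr f.quotKerEquivRange.toEquiv, hk] at h1
  rw [← hN, ← h1] at hcard
  have hpos : 0 < Module.finrank A H := Module.finrank_pos_iff.mpr inferInstance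
  have h3 : 0 < Nat.card (A ⧸ Ideal.span {n}) := Nat.card_pos
  apply Nat.eq_of_mul_eq_mul_left h3
  rw [hcard, ← pow_succ']
  congr 1
  omega

theorem count_main {A H : Type*} [CommRing A] [IsDomain A] [CommRing H]
    [Nontrivial H] [Algebra A H]
    [Module.Finite A H] [Module.Free A H] (n : A) [Finite (A ⧸ Ideal.span {n})]
    (hdiv : ∀ (a : A) (h : H), n • h = algebraMap A H a → n ∣ a)
    (k : ℕ) (hk : Module.finrank A H = k + 1) (b : Fin k → Ideal A) (i0 : Fin k)
    (hb : ∀ i, b i ≤ b i0) (P : Submodule A H) (hP : (1 : Submodule A H) ≤ P)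
    (e : (H ⧸ P) ≃ₗ[A] ((i : Fin k) → A ⧸ b i)) :
    P ≤ (1 : Submodule A H) ⊔ LinearMap.range (LinearMap.lsmul A H n) ↔
      b i0 ≤ Ideal.span {n} := by
  have hX := card_quot_X n hdiv
  rw [hk, Nat.add_sub_cancel] at hX
  set N := LinearMap.range (LinearMap.lsmul A H n) with hN
  have hXpos : 0 < Nat.card (H ⧸ ((1 : Submodule A H) ⊔ N)) := by
    rw [hX]; exact pow_pos Nat.card_pos _
  have hXfin : Finite (H ⧸ ((1 : Submodule A H) ⊔ N)) := Nat.finite_of_card_ne_zero hXpos.ne'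
  have hcF : Nat.card (Fin k → A ⧸ Ideal.span {n}) = Nat.card (A ⧸ Ideal.span {n}) ^ k := by
    rw [Nat.card_fun]; simp
  have hnz : ∀ x : A ⧸ Ideal.span {n}, n • x = 0 := by
    intro x
    obtain ⟨a, rfl⟩ := Submodule.mkQ_surjective _ x
    rw [← map_smul]
    refine (Submodule.Quotient.mk_eq_zero _).mpr ?_
    rw [Ideal.mem_span_singleton]
    simp
  constructor
  · intro hPN β hβ
    let G0 : (H ⧸ P) →ₗ[A] (H ⧸ ((1 : Submodule A H) ⊔ N)) := Submodule.factor hPN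
    let q : (Fin k → A) →ₗ[A] ((i : Fin k) → A ⧸ b i) :=
      LinearMap.pi fun i => (Submodule.mkQ (b i)).comp (LinearMap.proj i)
    let G : (Fin k → A) →ₗ[A] (H ⧸ ((1 : Submodule A H) ⊔ N)) :=
      G0.comp (e.symm.toLinearMap.comp q)
    have hq : Function.Surjective q := by
      intro g
      choose v hv using fun i => Submodule.mkQ_surjective (b i) (g i)
      exact ⟨v, funext hv⟩
    have hG : Function.Surjective G :=
      (Submodule.factor_surjective hPN).comp (e.symm.surjective.comp hq)
    let c : (Fin k → A) →ₗ[A] (Fin k → A ⧸ Ideal.span {n}) :=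
      LinearMap.compLeft (Submodule.mkQ (Ideal.span {n})) _
    have hc : Function.Surjective c := by
      intro g
      choose v hv using fun i => Submodule.mkQ_surjective (Ideal.span {n}) (g i)
      exact ⟨v, funext hv⟩
    have hcker : LinearMap.ker c ≤ LinearMap.ker G := by
      intro v hv
      have h1 : ∀ i, ∃ d, v i = n * d := by
        intro i
        have := (Submodule.Quotient.mk_eq_zero _).mp (congrFun hv i)
        rwa [Ideal.mem_span_singleton] at this
      choose d hd using h1
      have hv' : v = n • d := by ext i; simp [hd]
      rw [LinearMap.mem_ker, hv', map_smul]
      obtain ⟨h, hh⟩ := Submodule.mkQ_surjective _ (G d)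
      rw [← hh, ← map_smul]
      refine (Submodule.Quotient.mk_eq_zero _).mpr ?_
      exact Submodule.mem_sup_right ⟨h, rfl⟩
    let c' := (c.quotKerEquivOfSurjective hc)
    have h2 : Function.Surjective ((Submodule.liftQ _ G hcker).comp c'.symm.toLinearMap) := by
      have h2' : Function.Surjective (Submodule.liftQ _ G hcker) := by
        intro x
        obtain ⟨v, rfl⟩ := hG x
        exact ⟨Submodule.mkQ _ v, by simp⟩
      exact h2'.comp c'.symm.surjective
    have h3 := h2.bijective_of_nat_card_le (by rw [hX, hcF])
    have h4 : G (Pi.single i0 β) = 0 := by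
      have : q (Pi.single i0 β) = 0 := by
        ext i
        refine (Submodule.Quotient.mk_eq_zero _).mpr ?_
        by_cases hi : i = i0
        · subst hi; simpa using hβ
        · simp [hi]
      simp [G, this]
    have h5 : c (Pi.single i0 β) = 0 := by
      apply h3.1
      have : c'.symm (c (Pi.single i0 β)) = Submodule.mkQ _ (Pi.single i0 β) := by
        rw [LinearEquiv.symm_apply_eq]; rfl
      simp only [LinearMap.comp_apply, LinearEquiv.coe_coe, this, map_zero]
      exact h4
    have h6 := (Submodule.Quotient.mk_eq_zero _).mp (congrFun h5 i0)
    simpa using h6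
  · intro hbn x hx
    let q : ((i : Fin k) → A ⧸ b i) →ₗ[A] (Fin k → A ⧸ Ideal.span {n}) :=
      LinearMap.pi fun i => (Submodule.factor ((hb i).trans hbn)).comp (LinearMap.proj i)
    have hq : Function.Surjective q := by
      intro g
      choose v hv using fun i => Submodule.factor_surjective ((hb i).trans hbn) (g i)
      exact ⟨v, funext hv⟩
    let F : H →ₗ[A] (Fin k → A ⧸ Ideal.span {n}) := q.comp (e.toLinearMap.comp P.mkQ)
    have hF : Function.Surjective F := hq.comp (e.surjective.comp P.mkQ_surjective)
    have hPF : ∀ x ∈ P, F x = 0 := by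
      intro x hx
      have : P.mkQ x = 0 := (Submodule.Quotient.mk_eq_zero _).mpr hx
      simp only [F, LinearMap.comp_apply, this, map_zero]
    have hker : (1 : Submodule A H) ⊔ N ≤ LinearMap.ker F := by
      rw [sup_le_iff]
      refine ⟨fun x hx => hPF x (hP hx), ?_⟩
      rintro _ ⟨h, rfl⟩
      rw [LinearMap.mem_ker, LinearMap.lsmul_apply, map_smul]
      ext i
      exact hnz _
    have h2 : Function.Surjective (Submodule.liftQ _ F hker) := by
      intro x
      obtain ⟨v, rfl⟩ := hF x
      exact ⟨Submodule.mkQ _ v, by simp⟩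
    have h3 := h2.bijective_of_nat_card_le (by rw [hX, hcF])
    refine (Submodule.Quotient.mk_eq_zero _).mp (h3.1 ?_)
    rw [map_zero]
    exact hPF x hx


theorem density_aux {R C S J : Type*} [Ring R] [NoZeroDivisors R] [CommRing C]
    [Algebra C R] (hdvd : ∀ v : R, v ≠ 0 → ∃ a : R, ∃ c : C, algebraMap C R c ≠ 0 ∧
      a * v = algebraMap C R c)
    [Nontrivial R] [CommRing S] (ι : S →+* R) [Module S R]
    (hsmul : ∀ (e : S) (y : R), e • y = y * ι e)
    (hcent : ∀ c : R, (∀ e, c * ι e = ι e * c) → ∃ z, ι z = c)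
    [Fintype J] [DecidableEq J]
    (y : J → R) (hy : LinearIndependent S y)
    (W : Submodule S (J → R)) (hW : ∀ (x : R), ∀ v ∈ W, (fun i => x * v i) ∈ W)
    (hyW : y ∈ W) (T : Finset J) :
    ∃ c : C, algebraMap C R c ≠ 0 ∧ ∀ i ∈ T, ∃ v ∈ W, v i = algebraMap C R c ∧
      ∀ k ∈ T, k ≠ i → v k = 0 := by
  induction T using Finset.induction_on with
  | empty => exact ⟨1, by simp, by simp⟩
  | insert t T ht ih =>
    obtain ⟨c, hc, ih⟩ := ih
    by_cases hN : ∃ v ∈ W, (∀ k ∈ T, v k = 0) ∧ v t ≠ 0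
    · obtain ⟨v, hvW, hvT, hvt⟩ := hN
      obtain ⟨a, c', hc', hac⟩ := hdvd _ hvt
      refine ⟨c' * c, by simp [hc, hc'], ?_⟩
      intro i hi
      rcases Finset.mem_insert.mp hi with rfl | hi
      · refine ⟨_, hW (algebraMap C R c * a) _ hvW, ?_, ?_⟩
        · simp only [mul_assoc, hac, map_mul]
          exact (Algebra.commutes c _)
        · intro k hk hki
          rcases Finset.mem_insert.mp hk with rfl | hk
          · exact absurd rfl hki
          · simp [hvT k hk]
      · obtain ⟨w, hwW, hwi, hwk⟩ := ih i hi
        refine ⟨_, W.sub_mem (hW (algebraMap C R c') _ hwW) (hW (w t) _ (hW a _ hvW)), ?_, ?_⟩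
        · simp [hwi, hvT i hi]
        · intro k hk hki
          rcases Finset.mem_insert.mp hk with rfl | hk
          · simp [hac, (Algebra.commutes c' _)]
          · simp [hvT k hk, hwk k hk hki]
    · push Not at hN
      exfalso
      choose! v hvW hvi hvk using ih
      have hf : ∀ i ∈ T, ∃ z, ι z = v i t := by
        intro i hi
        apply hcent
        intro e
        have h1 := W.sub_mem (W.smul_mem e (hvW i hi)) (hW (ι e) _ (hvW i hi))
        have h2 := hN _ h1 ?_
        · simp only [Pi.sub_apply, Pi.smul_apply, hsmul] at h2
          exact sub_eq_zero.mp h2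
        · intro k hk
          by_cases hki : k = i
          · subst hki
            simp [hsmul, hvi k hi, (Algebra.commutes c _)]
          · simp [hsmul, hvk i hi k hk hki]
      choose! z hz using hf
      obtain ⟨ζ, hζ⟩ := hcent (algebraMap C R c) (fun e => Algebra.commutes _ _)
      have h1 : (fun i => algebraMap C R c * y i) - ∑ i ∈ T, (fun k => y i * v i k) ∈ W :=
        W.sub_mem (hW _ _ hyW) (W.sum_mem fun i hi => hW _ _ (hvW i hi))
      have h2 := hN _ h1 ?_
      · simp only [Pi.sub_apply, Finset.sum_apply] at h2
        rw [sub_eq_zero] at h2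
        have h3 : ζ • y t - ∑ i ∈ T, z i • y i = 0 := by
          rw [hsmul, hζ, ← Algebra.commutes, h2, sub_eq_zero]
          apply Finset.sum_congr rfl
          intro i hi
          rw [hsmul, hz i hi]
        have h4 := linearIndependent_iff'.mp hy (insert t T)
          (fun i => if i = t then ζ else - z i) ?_ t (by simp)
        · simp only [if_true] at h4
          rw [h4, map_zero] at hζ
          exact hc hζ.symm
        · rw [Finset.sum_insert ht, if_pos rfl, ← h3, sub_eq_add_neg, ← Finset.sum_neg_distrib]
          congr 1
          apply Finset.sum_congr rfl
          intro i hi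
          rw [if_neg (by rintro rfl; exact ht hi), neg_smul]
      · intro k hk
        simp only [Pi.sub_apply, Finset.sum_apply]
        rw [Finset.sum_eq_single k, hvi k hk, Algebra.commutes, sub_self]
        · intro i hi hik
          rw [hvk i hi k hk hik.symm, mul_zero]
        · exact fun h => absurd hk h

theorem density {R C S J I : Type*} [Ring R] [NoZeroDivisors R] [CommRing C]
    [Algebra C R] (hdvd : ∀ v : R, v ≠ 0 → ∃ a : R, ∃ c : C, algebraMap C R c ≠ 0 ∧
      a * v = algebraMap C R c)
    [Nontrivial R] [CommRing S] [Nontrivial S] (ι : S →+* R) [Module S R]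
    (hsmul : ∀ (e : S) (y : R), e • y = y * ι e)
    (hcent : ∀ c : R, (∀ e, c * ι e = ι e * c) → ∃ z, ι z = c)
    [Fintype J] [Fintype I] (u : I → R) (hu : Submodule.span C (Set.range u) = ⊤)
    (y : J → R) (hy : LinearIndependent S y) :
    Fintype.card J * Fintype.card J ≤ Fintype.card I := by
  classical
  let U : I → J → R := fun k i => u k * y i
  let W : Submodule S (J → R) := Submodule.span S (Set.range U)
  have hC : ∀ (c : C), ∀ v ∈ W, (fun i => algebraMap C R c * v i) ∈ W := by
    intro c v hv
    obtain ⟨ζ, hζ⟩ := hcent (algebraMap C R c) (fun e => Algebra.commutes _ _)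
    convert W.smul_mem ζ hv using 1
    ext i
    simp [hsmul, hζ, Algebra.commutes]
  have hxy : ∀ x : R, (fun i => x * y i) ∈ W := by
    intro x
    have hx : x ∈ Submodule.span C (Set.range u) := hu ▸ Submodule.mem_top
    induction hx using Submodule.span_induction with
    | mem x hx =>
      obtain ⟨k, rfl⟩ := hx
      exact Submodule.subset_span ⟨k, rfl⟩
    | zero =>
      simp only [zero_mul, Pi.zero_apply, mul_zero]
      exact W.zero_mem
    | add a b _ _ ha hb => 
      simp only [add_mul]
      exact W.add_mem ha hb
    | smul c a _ ha => simpa only [Algebra.smul_def, mul_assoc] using hC c _ ha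
  have hW : ∀ (x : R), ∀ v ∈ W, (fun i => x * v i) ∈ W := by
    intro x v hv
    induction hv using Submodule.span_induction with
    | mem v hv =>
      obtain ⟨k, rfl⟩ := hv
      simpa only [U, mul_assoc] using hxy (x * u k)
    | zero =>
      simp only [zero_mul, Pi.zero_apply, mul_zero]
      exact W.zero_mem
    | add a b _ _ ha hb => 
      simp only [Pi.add_apply, mul_add]
      exact W.add_mem ha hb
    | smul c a _ ha =>
      convert W.smul_mem c ha using 1
      ext i
      simp [hsmul, mul_assoc]
  obtain ⟨c, hc, hv⟩ := density_aux hdvd ι hsmul hcent y hy W hW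
    (by simpa using hxy 1) Finset.univ
  let lc : R →ₗ[S] R :=
    { toFun := fun x => algebraMap C R c * x
      map_add' := fun a b => mul_add _ _ _
      map_smul' := fun e a => by simp [hsmul, mul_assoc] }
  have hlc : LinearMap.ker lc = ⊥ := by
    rw [LinearMap.ker_eq_bot']
    intro x hx
    exact (mul_eq_zero.mp hx).resolve_left hc
  have hli := Pi.linearIndependent_single (R := S) (η := J) (Ms := fun _ => R)
    (fun _ j => lc (y j)) (fun _ => hy.map' lc hlc)
  have hfin : Fintype (Set.range U) := Fintype.ofFinite _
  have := linearIndependent_le_span_aux' _ hli (Set.range U) ?_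
  · refine le_trans (le_of_eq ?_) (this.trans (Fintype.card_range_le U))
    simp
  · rintro _ ⟨⟨i, k⟩, rfl⟩
    obtain ⟨v, hvW, hvi, hvk⟩ := hv i (Finset.mem_univ _)
    suffices h : (Pi.single i (lc (y k)) : J → R) = fun l => y k * v l by
      have := hW (y k) v hvW
      rw [← h] at this
      exact this
    ext l
    by_cases hl : l = i
    · subst hl
      simp [lc, hvi, Algebra.commutes]
    · simp [hl, hvk l (Finset.mem_univ _) hl]




section TwistedBasics

theorem frob_add (Fq : Type*) {M : Type*} [Field Fq] [Fintype Fq] [CommRing M] [Algebra Fq M]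
    (i : ℕ) (x y : M) : (x + y) ^ Fintype.card Fq ^ i =
      x ^ Fintype.card Fq ^ i + y ^ Fintype.card Fq ^ i := by
  induction i with
  | zero => simp
  | succ i ih =>
    rw [pow_succ, pow_mul, pow_mul, pow_mul, ih]
    exact map_add (FiniteField.frobeniusAlgHom Fq M) _ _

variable (Fq : Type*) {L Ω : Type*} [Field Fq] [Fintype Fq] [CommRing L] [Algebra Fq L]

theorem q_pos : 0 < Fintype.card Fq := Fintype.card_pos

theorem q_pow_ne (i : ℕ) : Fintype.card Fq ^ i ≠ 0 := (pow_pos (q_pos Fq) i).ne'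

theorem tmul_mono_mono (i j : ℕ) (a b : L) :
    tmul (Fintype.card Fq) (monomial i a) (monomial j b) =
      monomial (i + j) (a * b ^ Fintype.card Fq ^ i) := by
  unfold tmul
  rw [sum_monomial_index, sum_monomial_index]
  · rw [zero_pow (q_pow_ne Fq i)]; simp
  · simp [Polynomial.sum]

theorem tmul_add_l (q : ℕ) (f g h : L[X]) : tmul q (f + g) h = tmul q f h + tmul q g h := by
  unfold tmul
  rw [sum_add_index]
  · intro i; simp [Polynomial.sum]
  · intro i a b
    rw [← Polynomial.sum_add]
    congr 1
    ext j c
    rw [add_mul, map_add]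

theorem tmul_add_r (f g h : L[X]) : tmul (Fintype.card Fq) f (g + h) =
    tmul (Fintype.card Fq) f g + tmul (Fintype.card Fq) f h := by
  unfold tmul
  rw [← Polynomial.sum_add]
  congr 1
  funext i a
  rw [sum_add_index]
  · intro j; rw [zero_pow (q_pow_ne Fq i)]; simp
  · intro j b c
    rw [frob_add, mul_add, map_add]

theorem tmul_asc (f g h : L[X]) : tmul (Fintype.card Fq) (tmul (Fintype.card Fq) f g) h =
    tmul (Fintype.card Fq) f (tmul (Fintype.card Fq) g h) := by
  induction f using Polynomial.induction_on' with
  | add f f' hf hf' => simp only [tmul_add_l, hf, hf']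
  | monomial i a =>
    induction g using Polynomial.induction_on' with
    | add g g' hg hg' => simp only [tmul_add_l, tmul_add_r, hg, hg']
    | monomial j b =>
      induction h using Polynomial.induction_on' with
      | add h h' hh hh' => simp only [tmul_add_r, hh, hh']
      | monomial k c =>
        simp only [tmul_mono_mono]
        rw [add_assoc, mul_pow, ← pow_mul, ← pow_add, mul_assoc, add_comm j i]

theorem tmul_one_l (f : L[X]) : tmul (Fintype.card Fq) 1 f = f := by
  induction f using Polynomial.induction_on' with
  | add f f' hf hf' => simp only [tmul_add_r, hf, hf']
  | monomial i a =>
    rw [← monomial_zero_one, tmul_mono_mono]; simp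

theorem tmul_one_r (f : L[X]) : tmul (Fintype.card Fq) f 1 = f := by
  induction f using Polynomial.induction_on' with
  | add f f' hf hf' => simp only [tmul_add_l, hf, hf']
  | monomial i a =>
    rw [← monomial_zero_one, tmul_mono_mono]; simp

theorem tmul_zero_l (q : ℕ) (f : L[X]) : tmul q 0 f = 0 := by
  simp [tmul]

theorem tmul_zero_r (q : ℕ) (f : L[X]) : tmul q f 0 = 0 := by
  simp [tmul, Polynomial.sum]

theorem tmul_coeff_top (f g : L[X]) :
    (tmul (Fintype.card Fq) f g).coeff (f.natDegree + g.natDegree) =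
      f.leadingCoeff * g.leadingCoeff ^ Fintype.card Fq ^ f.natDegree := by
  unfold tmul
  simp only [Polynomial.sum, finsetSum_coeff, coeff_monomial]
  rw [Finset.sum_eq_single f.natDegree, Finset.sum_eq_single g.natDegree]
  · simp
  · intro j hj hj'
    rw [if_neg (by omega)]
  · intro h
    rw [notMem_support_iff.mp h, zero_pow (q_pow_ne Fq _)]; simp
  · intro i hi hi'
    apply Finset.sum_eq_zero
    intro j hj
    have h1 := le_natDegree_of_mem_supp i hi
    have h2 := le_natDegree_of_mem_supp j hj
    rw [if_neg (by omega)]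
  · intro h
    rw [notMem_support_iff.mp h]; simp

theorem tmul_natDegree_le (f g : L[X]) :
    (tmul (Fintype.card Fq) f g).natDegree ≤ f.natDegree + g.natDegree := by
  unfold tmul
  simp only [Polynomial.sum]
  refine natDegree_sum_le_of_forall_le _ _ fun i hi => ?_
  refine natDegree_sum_le_of_forall_le _ _ fun j hj => ?_
  refine (natDegree_monomial_le _).trans ?_
  exact add_le_add (le_natDegree_of_mem_supp i hi) (le_natDegree_of_mem_supp j hj)

theorem tmul_ne_zero [IsDomain L] {f g : L[X]} (hf : f ≠ 0) (hg : g ≠ 0) :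
    tmul (Fintype.card Fq) f g ≠ 0 := by
  intro h
  have := tmul_coeff_top Fq f g
  rw [h, coeff_zero] at this
  have h2 := mul_ne_zero (leadingCoeff_ne_zero.mpr hf)
    (pow_ne_zero (Fintype.card Fq ^ f.natDegree) (leadingCoeff_ne_zero.mpr hg))
  exact h2 this.symm

theorem tmul_natDegree [IsDomain L] {f g : L[X]} (hf : f ≠ 0) (hg : g ≠ 0) :
    (tmul (Fintype.card Fq) f g).natDegree = f.natDegree + g.natDegree := by
  apply le_antisymm (tmul_natDegree_le Fq f g)
  apply le_natDegree_of_ne_zero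
  rw [tmul_coeff_top]
  exact mul_ne_zero (leadingCoeff_ne_zero.mpr hf)
    (pow_ne_zero (Fintype.card Fq ^ f.natDegree) (leadingCoeff_ne_zero.mpr hg))

/-- Right division with remainder. -/
theorem tmul_div [IsDomain L] (hL : IsField L) (g : L[X]) (hg : g ≠ 0) (N : ℕ) :
    ∀ f : L[X], f.degree < N → ∃ u v : L[X], f = tmul (Fintype.card Fq) u g + v ∧
      v.degree < g.degree ∧ (u = 0 ∨ u.natDegree + g.natDegree ≤ f.natDegree) := by
  induction N with
  | zero =>
    intro f hf
    have : f = 0 := by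
      by_contra h
      rw [degree_eq_natDegree h] at hf
      exact absurd hf (by simp)
    subst this
    exact ⟨0, 0, by simp [tmul_zero_l], by simpa using bot_lt_iff_ne_bot.mpr (degree_ne_bot.mpr hg),
      Or.inl rfl⟩
  | succ N ih =>
    intro f hf
    by_cases hlt : f.degree < g.degree
    · exact ⟨0, f, by simp [tmul_zero_l], hlt, Or.inl rfl⟩
    · push Not at hlt
      have hf0 : f ≠ 0 := by
        rintro rfl
        simp only [degree_zero, le_bot_iff, degree_eq_bot] at hlt
        exact hg hlt
      have hle : g.natDegree ≤ f.natDegree := natDegree_le_natDegree hlt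
      obtain ⟨k, hk⟩ := Nat.exists_eq_add_of_le' hle
      obtain ⟨β, hβ⟩ := hL.mul_inv_cancel
        (pow_ne_zero (Fintype.card Fq ^ k) (leadingCoeff_ne_zero.mpr hg))
      have hβ0 : β ≠ 0 := by rintro rfl; simp at hβ
      have hc0 : f.leadingCoeff * β ≠ 0 := mul_ne_zero (leadingCoeff_ne_zero.mpr hf0) hβ0
      let m : L[X] := monomial k (f.leadingCoeff * β)
      have hmd : m.natDegree = k := natDegree_monomial_eq k hc0
      have hm0 : m ≠ 0 := by simpa [m] using hc0
      have hml : m.leadingCoeff = f.leadingCoeff * β := leadingCoeff_monomial _ _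
      have hdeg := tmul_natDegree Fq hm0 hg
      have hlc := tmul_coeff_top Fq m g
      rw [hmd, hml, mul_assoc, mul_comm β, hβ, mul_one, ← hk] at hlc
      rw [hmd, ← hk] at hdeg
      have hsub : (f - tmul (Fintype.card Fq) m g).degree < f.degree := by
        apply degree_sub_lt_left _ hf0
        · rw [leadingCoeff, leadingCoeff, hdeg, hlc]; rfl
        · rw [degree_eq_natDegree hf0, degree_eq_natDegree (tmul_ne_zero Fq hm0 hg), hdeg]
      obtain ⟨u, v, huv, hv, hu⟩ := ih (f - tmul (Fintype.card Fq) m g) (by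
        rw [degree_eq_natDegree hf0] at hsub hf
        refine lt_of_lt_of_le hsub ?_
        have : f.natDegree < N + 1 := by exact_mod_cast hf
        exact_mod_cast Nat.lt_succ_iff.mp this)
      refine ⟨m + u, v, ?_, hv, ?_⟩
      · rw [tmul_add_l, add_assoc, ← huv]; ring
      · right
        have h1 : u.natDegree ≤ k := by
          rcases hu with rfl | hu
          · simp
          · have := natDegree_le_natDegree hsub.le
            omega
        have h2 := natDegree_add_le m u
        rw [hmd, max_eq_left h1] at h2
        omega

theorem tmul_div' [IsDomain L] (hL : IsField L) (g : L[X]) (hg : g ≠ 0) (f : L[X]) :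
    ∃ u v : L[X], f = tmul (Fintype.card Fq) u g + v ∧
      v.degree < g.degree ∧ (u = 0 ∨ u.natDegree + g.natDegree ≤ f.natDegree) :=
  tmul_div Fq hL g hg (f.natDegree + 1) f
    (lt_of_le_of_lt degree_le_natDegree (by exact_mod_cast Nat.lt_succ_self _))

variable [Field Ω] [Algebra L Ω]

theorem teval_add_l (q : ℕ) (f g : L[X]) (x : Ω) :
    teval q (f + g) x = teval q f x + teval q g x := by
  unfold teval
  rw [sum_add_index]
  · intro i; simp
  · intro i a b; rw [map_add, add_mul]

theorem teval_mono (q : ℕ) (i : ℕ) (a : L) (x : Ω) :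
    teval q (monomial i a) x = algebraMap L Ω a * x ^ q ^ i := by
  unfold teval
  rw [sum_monomial_index]; simp

theorem teval_add_r [Algebra Fq Ω] (f : L[X]) (x y : Ω) : teval (Fintype.card Fq) f (x + y) =
    teval (Fintype.card Fq) f x + teval (Fintype.card Fq) f y := by
  unfold teval
  rw [← Polynomial.sum_add]
  congr 1
  funext i a
  rw [frob_add, mul_add]

theorem teval_zero_r (f : L[X]) : teval (Fintype.card Fq) f (0 : Ω) = 0 := by
  unfold teval
  simp [Polynomial.sum]

theorem teval_tmul [Algebra Fq Ω] (f g : L[X]) (x : Ω) :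
    teval (Fintype.card Fq) (tmul (Fintype.card Fq) f g) x =
    teval (Fintype.card Fq) f (teval (Fintype.card Fq) g x) := by
  induction f using Polynomial.induction_on' with
  | add f f' hf hf' => simp only [tmul_add_l, teval_add_l, hf, hf']
  | monomial i a =>
    induction g using Polynomial.induction_on' with
    | add g g' hg hg' => simp only [tmul_add_r, teval_add_l, teval_add_r, hg, hg']
    | monomial j b =>
      simp only [tmul_mono_mono, teval_mono]
      rw [mul_pow, ← pow_mul, ← pow_add, map_mul, map_pow, mul_assoc, add_comm i j]

/-- The additive polynomial attached to a twisted polynomial. -/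
noncomputable def linPoly (Ω : Type*) [Field Ω] [Algebra L Ω] (q : ℕ) (f : L[X]) : Polynomial Ω :=
  ∑ i ∈ f.support, monomial (q ^ i) (algebraMap L Ω (f.coeff i))

theorem linPoly_eval (q : ℕ) (f : L[X]) (x : Ω) : (linPoly Ω q f).eval x = teval q f x := by
  simp [linPoly, teval, Polynomial.sum, eval_finsetSum]

theorem linPoly_coeff (f : L[X]) (k : ℕ) :
    (linPoly Ω (Fintype.card Fq) f).coeff (Fintype.card Fq ^ k) =
      algebraMap L Ω (f.coeff k) := by
  unfold linPoly
  simp only [finsetSum_coeff, coeff_monomial]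
  rw [Finset.sum_eq_single k]
  · simp
  · intro i _ hi
    rw [if_neg]
    intro h
    exact hi (Nat.pow_right_injective (Fintype.one_lt_card (α := Fq)) h)
  · intro h
    rw [notMem_support_iff.mp h]; simp

theorem linPoly_natDegree_le (f : L[X]) :
    (linPoly Ω (Fintype.card Fq) f).natDegree ≤ Fintype.card Fq ^ f.natDegree := by
  unfold linPoly
  refine natDegree_sum_le_of_forall_le _ _ fun i hi => ?_
  refine (natDegree_monomial_le _).trans ?_
  exact Nat.pow_le_pow_right (q_pos Fq) (le_natDegree_of_mem_supp i hi)

theorem linPoly_deriv [Algebra Fq Ω] (f : L[X]) :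
    derivative (linPoly Ω (Fintype.card Fq) f) = C (algebraMap L Ω (f.coeff 0)) := by
  have hq : ((Fintype.card Fq : ℕ) : Ω) = 0 := by
    rw [← map_natCast (algebraMap Fq Ω), FiniteField.cast_card_eq_zero, map_zero]
  unfold linPoly
  rw [map_sum, Finset.sum_eq_single 0]
  · simp [derivative_monomial]
  · intro i _ hi
    rw [derivative_monomial, Nat.cast_pow, hq, zero_pow hi]; simp
  · intro h
    rw [notMem_support_iff.mp h]; simp

/-- A twisted polynomial killing the kernel of a separable `g` is right divisible by `g`. -/
theorem tors_div [IsDomain L] (hL : IsField L) [Algebra Fq Ω] [IsAlgClosed Ω]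
    (g w : L[X]) (hg : g.coeff 0 ≠ 0)
    (h : ∀ x : Ω, teval (Fintype.card Fq) g x = 0 → teval (Fintype.card Fq) w x = 0) :
    ∃ u, w = tmul (Fintype.card Fq) u g := by
  classical
  have hinj : Function.Injective (algebraMap L Ω) := by
    letI := hL.toField
    exact (algebraMap L Ω).injective
  have hg0 : g ≠ 0 := by rintro rfl; simp at hg
  obtain ⟨u, v, hw, hv, -⟩ := tmul_div' Fq hL g hg0 w
  refine ⟨u, ?_⟩
  suffices hv0 : v = 0 by rw [hw, hv0, add_zero]
  by_contra hv0
  have hvd : v.natDegree < g.natDegree := natDegree_lt_natDegree hv0 hv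
  have hvz : ∀ x : Ω, teval (Fintype.card Fq) g x = 0 → teval (Fintype.card Fq) v x = 0 := by
    intro x hx
    have := h x hx
    rwa [hw, teval_add_l, teval_tmul, hx, teval_zero_r, zero_add] at this
  set G := linPoly Ω (Fintype.card Fq) g with hG
  have hGdeg : G.natDegree = Fintype.card Fq ^ g.natDegree := by
    apply le_antisymm (linPoly_natDegree_le Fq g)
    apply le_natDegree_of_ne_zero
    rw [linPoly_coeff]
    exact (map_ne_zero_iff _ hinj).mpr (leadingCoeff_ne_zero.mpr hg0)
  have hsep : G.Separable := by
    unfold Polynomial.Separable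
    rw [hG, linPoly_deriv]
    have hu : IsUnit (C (algebraMap L Ω (g.coeff 0))) :=
      isUnit_C.mpr (isUnit_iff_ne_zero.mpr ((map_ne_zero_iff _ hinj).mpr hg))
    exact isCoprime_one_right.of_isCoprime_of_dvd_right hu.dvd
  have hG0 : G ≠ 0 := hsep.ne_zero
  have hcard : G.roots.toFinset.card = Fintype.card Fq ^ g.natDegree := by
    rw [Multiset.toFinset_card_of_nodup (nodup_roots hsep), ← hGdeg]
    exact (IsAlgClosed.splits G).natDegree_eq_card_roots.symm
  have hV : linPoly Ω (Fintype.card Fq) v = 0 := by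
    apply eq_zero_of_natDegree_lt_card_of_eval_eq_zero' _ G.roots.toFinset
    · intro x hx
      rw [linPoly_eval]
      apply hvz
      rw [← linPoly_eval]
      simpa [hG0] using hx
    · rw [hcard]
      exact (linPoly_natDegree_le Fq v).trans_lt
        (Nat.pow_lt_pow_right (Fintype.one_lt_card) hvd)
  have := linPoly_coeff Fq (Ω := Ω) v v.natDegree
  rw [hV, coeff_zero] at this
  exact (map_ne_zero_iff _ hinj).mpr (leadingCoeff_ne_zero.mpr hv0) this.symm

end TwistedBasics


/-- The ring of twisted polynomials. -/
def TP (_Fq L : Type*) [CommRing L] : Type _ := Polynomial L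

section TPring

variable (Fq : Type*) {L : Type*} [Field Fq] [Fintype Fq] [CommRing L] [Algebra Fq L]

noncomputable instance instAddCommGroupTP : AddCommGroup (TP Fq L) :=
  inferInstanceAs (AddCommGroup (Polynomial L))

noncomputable instance instRingTP : Ring (TP Fq L) :=
  { instAddCommGroupTP Fq (L := L) with
    mul := fun f g => tmul (L := L) (Fintype.card Fq) f g
    one := (1 : Polynomial L)
    left_distrib := fun f g h => tmul_add_r Fq (L := L) f g h
    right_distrib := fun f g h => tmul_add_l (L := L) (Fintype.card Fq) f g h
    zero_mul := fun f => tmul_zero_l (L := L) (Fintype.card Fq) f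
    mul_zero := fun f => tmul_zero_r (L := L) (Fintype.card Fq) f
    mul_assoc := fun f g h => tmul_asc Fq (L := L) f g h
    one_mul := fun f => tmul_one_l Fq (L := L) f
    mul_one := fun f => tmul_one_r Fq (L := L) f }

/-- View a polynomial as a twisted polynomial. -/
noncomputable def toTP : L[X] ≃+ TP Fq L := AddEquiv.refl _

theorem toTP_tmul (f g : L[X]) :
    toTP Fq (tmul (Fintype.card Fq) f g) = toTP Fq f * toTP Fq g := rfl

theorem toTP_one : toTP Fq (1 : L[X]) = 1 := rfl

theorem toTP_mono_mul (i j : ℕ) (a b : L) :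
    toTP Fq (monomial i a) * toTP Fq (monomial j b) =
      toTP Fq (monomial (i + j) (a * b ^ Fintype.card Fq ^ i)) := by
  rw [← toTP_tmul, tmul_mono_mono]

theorem TP_induction {P : TP Fq L → Prop} (hadd : ∀ f g, P f → P g → P (f + g))
    (hmono : ∀ i a, P (toTP Fq (monomial i a))) (f : TP Fq L) : P f := by
  have : ∀ g : L[X], P (toTP Fq g) := by
    intro g
    induction g using Polynomial.induction_on' with
    | add f g hf hg => rw [map_add]; exact hadd _ _ hf hg
    | monomial i a => exact hmono i a
  simpa using this ((toTP Fq).symm f)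

instance [IsDomain L] : NoZeroDivisors (TP Fq L) where
  eq_zero_or_eq_zero_of_mul_eq_zero := by
    intro f g h
    by_contra hc
    push Not at hc
    exact tmul_ne_zero Fq (L := L) hc.1 hc.2 h

instance [IsDomain L] : Nontrivial (TP Fq L) :=
  inferInstanceAs (Nontrivial (Polynomial L))

theorem scal_comm (c : Fq) (x : TP Fq L) :
    toTP Fq (monomial 0 (algebraMap Fq L c)) * x =
      x * toTP Fq (monomial 0 (algebraMap Fq L c)) := by
  refine TP_induction Fq (P := fun x => toTP Fq (monomial 0 (algebraMap Fq L c)) * x =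
      x * toTP Fq (monomial 0 (algebraMap Fq L c))) ?_ ?_ x
  · intro f g hf hg
    rw [mul_add, add_mul, hf, hg]
  · intro i a
    rw [toTP_mono_mul, toTP_mono_mul, ← map_pow, FiniteField.pow_card_pow]
    simp [mul_comm]

/-- Constants. -/
noncomputable def scal : Fq →+* TP Fq L where
  toFun c := toTP Fq (monomial 0 (algebraMap Fq L c))
  map_one' := by rw [map_one, monomial_zero_one, toTP_one]
  map_mul' := fun a b => by rw [toTP_mono_mul]; simp
  map_zero' := by simp
  map_add' := fun a b => by simp

variable (d : ℕ)

theorem frob_comm (hd : ∀ l : L, l ^ Fintype.card Fq ^ d = l) (k : ℕ) (x : TP Fq L) :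
    toTP Fq (monomial (d * k) 1) * x = x * toTP Fq (monomial (d * k) 1) := by
  refine TP_induction Fq (P := fun x => toTP Fq (monomial (d * k) 1) * x =
      x * toTP Fq (monomial (d * k) 1)) ?_ ?_ x
  · intro f g hf hg
    rw [mul_add, add_mul, hf, hg]
  · intro i a
    have : ∀ a : L, a ^ Fintype.card Fq ^ (d * k) = a := by
      intro a
      induction k with
      | zero => simp
      | succ k ih => rw [mul_add, pow_add, pow_mul, ih, mul_one, hd]
    rw [toTP_mono_mul, toTP_mono_mul, this]
    simp [add_comm]

/-- `c(π)`, for a polynomial `c`. -/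
noncomputable def cen (hd : ∀ l : L, l ^ Fintype.card Fq ^ d = l) : Fq[X] →+* TP Fq L :=
  Polynomial.eval₂RingHom' (scal Fq) (toTP Fq (monomial d 1)) (fun c => scal_comm Fq c _)

theorem frob_pow (k : ℕ) : (toTP Fq (monomial d (1 : L))) ^ k = toTP Fq (monomial (d * k) 1) := by
  induction k with
  | zero => simp [monomial_zero_one, toTP_one]
  | succ k ih => rw [pow_succ, ih, toTP_mono_mul, mul_add]; simp

theorem cen_mono (hd : ∀ l : L, l ^ Fintype.card Fq ^ d = l) (k : ℕ) (c : Fq) :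
    cen Fq d hd (monomial k c) = toTP Fq (monomial (d * k) (algebraMap Fq L c)) := by
  change eval₂ _ _ _ = _
  rw [eval₂_monomial, frob_pow]
  change toTP Fq (monomial 0 (algebraMap Fq L c)) * _ = _
  rw [toTP_mono_mul]; simp

theorem cen_comm (hd : ∀ l : L, l ^ Fintype.card Fq ^ d = l) (c : Fq[X]) (x : TP Fq L) :
    cen Fq d hd c * x = x * cen Fq d hd c := by
  induction c using Polynomial.induction_on' with
  | add f g hf hg => rw [map_add, mul_add, add_mul, hf, hg]
  | monomial k c =>
    rw [← C_mul_X_pow_eq_monomial, map_mul, map_pow]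
    have h1 : cen Fq d hd (C c) = toTP Fq (monomial 0 (algebraMap Fq L c)) := by
      rw [← monomial_zero_left, cen_mono]; simp
    have h2 : cen Fq d hd X ^ k = toTP Fq (monomial (d * k) 1) := by
      rw [← frob_pow, ← monomial_one_one_eq_X, cen_mono]; simp
    rw [h1, h2, mul_assoc, frob_comm Fq d hd, ← mul_assoc, scal_comm, mul_assoc]

theorem cen_inj [Nontrivial L] (hd : ∀ l : L, l ^ Fintype.card Fq ^ d = l) (hd0 : 0 < d)
    (c : Fq[X]) (hc : c ≠ 0) : cen (L := L) Fq d hd c ≠ 0 := by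
  have h : ∀ c, cen (L := L) Fq d hd c =
      toTP Fq (expand L d (c.map (algebraMap Fq L))) := by
    intro c
    induction c using Polynomial.induction_on' with
    | add f g hf hg => rw [map_add, hf, hg, Polynomial.map_add, map_add, map_add]
    | monomial k c => rw [cen_mono, map_monomial, expand_monomial, mul_comm]
  rw [h]
  simpa [expand_eq_zero hd0] using hc

theorem density_TP [IsDomain L] [Module.Finite Fq L] (hd : ∀ l : L, l ^ Fintype.card Fq ^ d = l)
    (hd0 : 0 < d) (hdr : Module.finrank Fq L = d)
    {S J : Type*} [CommRing S] [Nontrivial S] (ι : S →+* TP Fq L) [Module S (TP Fq L)]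
    (hsmul : ∀ (e : S) (y : TP Fq L), e • y = y * ι e)
    (hcent : ∀ c : TP Fq L, (∀ e, c * ι e = ι e * c) → ∃ z, ι z = c)
    [Fintype J] (y : J → TP Fq L) (hy : LinearIndependent S y) :
    Fintype.card J * Fintype.card J ≤ d * d := by
  letI : Algebra Fq[X] (TP Fq L) := (cen Fq d hd).toAlgebra' (cen_comm Fq d hd)
  have halg : ∀ c, algebraMap Fq[X] (TP Fq L) c = cen Fq d hd c := fun _ => rfl
  let B := Module.finBasis Fq L
  let u : Fin (Module.finrank Fq L) × Fin d → TP Fq L := fun x => toTP Fq (monomial x.2 (B x.1))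
  have hu : Submodule.span Fq[X] (Set.range u) = ⊤ := by
    rw [eq_top_iff]
    rintro x -
    refine TP_induction Fq (P := fun x => x ∈ Submodule.span Fq[X] (Set.range u)) ?_ ?_ x
    · intro f g hf hg
      exact Submodule.add_mem _ hf hg
    · intro k a
      rw [← B.sum_repr a, map_sum, map_sum]
      apply Submodule.sum_mem
      intro l _
      have : toTP Fq (monomial k (B.repr a l • B l)) =
          (monomial (k / d) (B.repr a l) : Fq[X]) • u (l, ⟨k % d, Nat.mod_lt _ hd0⟩) := by
        rw [Algebra.smul_def, Algebra.smul_def, halg, cen_mono, toTP_mono_mul, Nat.div_add_mod]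
        congr 3
        have : ∀ a : L, a ^ Fintype.card Fq ^ (d * (k / d)) = a := by
          intro a
          generalize k / d = k
          induction k with
          | zero => simp
          | succ k ih => rw [mul_add, pow_add, pow_mul, ih, mul_one, hd]
        rw [this]
      rw [this]
      exact Submodule.smul_mem _ _ (Submodule.subset_span ⟨_, rfl⟩)
  have hfin : Module.Finite Fq[X] (TP Fq L) :=
    ⟨⟨(Set.finite_range u).toFinset, by simpa using hu⟩⟩
  have hdvd : ∀ v : TP Fq L, v ≠ 0 → ∃ a : TP Fq L, ∃ c : Fq[X],
      algebraMap Fq[X] (TP Fq L) c ≠ 0 ∧ a * v = algebraMap Fq[X] (TP Fq L) c := by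
    intro v hv
    obtain ⟨c, hc, a, ha⟩ := (Algebra.IsIntegral.isIntegral (R := Fq[X]) v).isAlgebraic.exists_nonzero_dvd
      (mem_nonZeroDivisors_of_ne_zero hv)
    refine ⟨a, c, cen_inj Fq d hd hd0 c hc, ?_⟩
    apply mul_left_cancel₀ hv
    rw [← mul_assoc, ← ha, Algebra.commutes]
  have := density hdvd ι hsmul hcent u hu y hy
  simpa [hdr] using this

/-- Module structure by right multiplication. -/
@[reducible] def rightMod {S R : Type*} [CommRing S] [Ring R] (ι : S →+* R) : Module S R where
  smul e y := y * ι e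
  one_smul y := by change y * ι 1 = y; simp
  mul_smul a b y := by
    change y * ι (a * b) = (y * ι b) * ι a
    rw [mul_comm, map_mul, mul_assoc]
  smul_zero a := zero_mul _
  smul_add a x y := add_mul _ _ _
  add_smul a b y := by change y * ι (a + b) = y * ι a + y * ι b; rw [map_add, mul_add]
  zero_smul y := by change y * ι 0 = 0; simp

theorem finite_TP [IsDomain L] [Finite L] (hL : IsField L) (r : ℕ) (hr : 0 < r)
    (Φ : Fq[X] →+* TP Fq L) (hΦ : ((toTP Fq).symm (Φ X)).natDegree = r)
    [Module Fq[X] (TP Fq L)] (hsmul : ∀ (e : Fq[X]) (y : TP Fq L), e • y = y * Φ e) :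
    Module.Finite Fq[X] (TP Fq L) := by
  let u : L × Fin r → TP Fq L := fun x => toTP Fq (monomial x.2 x.1)
  refine ⟨⟨(Set.finite_range u).toFinset, ?_⟩⟩
  rw [Set.Finite.coe_toFinset, eq_top_iff]
  rintro x -
  set g := (toTP Fq).symm (Φ X) with hg
  have hg0 : g ≠ 0 := by rintro h; rw [h] at hΦ; simp at hΦ; omega
  have key : ∀ N : ℕ, ∀ f : L[X], f.natDegree < N →
      toTP Fq f ∈ Submodule.span Fq[X] (Set.range u) := by
    intro N
    induction N with
    | zero => intro f hf; omega
    | succ N ih =>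
      intro f hf
      obtain ⟨a, v, hav, hv, ha⟩ := tmul_div' Fq hL g hg0 f
      rw [hav, map_add]
      apply Submodule.add_mem
      · have h1 : toTP Fq a ∈ Submodule.span Fq[X] (Set.range u) := by
          rcases ha with rfl | ha
          · simp
          · exact ih a (by omega)
        have := Submodule.smul_mem _ (X : Fq[X]) h1
        rwa [hsmul] at this
      · rw [v.as_sum_support, map_sum]
        apply Submodule.sum_mem
        intro i hi
        have h1 : i < r := by
          rw [← hΦ]
          have h2 := le_natDegree_of_mem_supp i hi
          have h3 : v ≠ 0 := by rintro rfl; simp at hi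
          have := natDegree_lt_natDegree h3 hv
          omega
        exact Submodule.subset_span ⟨(v.coeff i, ⟨i, h1⟩), rfl⟩
  simpa using key _ ((toTP Fq).symm x) (Nat.lt_succ_self _)

theorem rank_TP [IsDomain L] [Finite L] (r : ℕ)
    (hdr : Module.finrank Fq L = d)
    (Φ : Fq[X] →+* TP Fq L) (hr : 0 < r) (hΦ : ((toTP Fq).symm (Φ X)).natDegree = r)
    [Module Fq[X] (TP Fq L)] (hsmul : ∀ (e : Fq[X]) (y : TP Fq L), e • y = y * Φ e)
    [Module.Finite Fq[X] (TP Fq L)] [Module.Free Fq[X] (TP Fq L)] :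
    d * r ≤ Module.finrank Fq[X] (TP Fq L) := by
  have hcard := card_quot_smul (M := TP Fq L) (X : Fq[X])
  have hA : Nat.card (Fq[X] ⧸ Ideal.span {(X : Fq[X])}) = Fintype.card Fq := by
    have h1 : Module.finrank Fq (Fq[X] ⧸ Ideal.span {(X : Fq[X])}) = 1 := by
      rw [finrank_quotient_span_eq_natDegree, natDegree_X]
    have : Module.Finite Fq (Fq[X] ⧸ Ideal.span {(X : Fq[X])}) :=
      Module.finite_of_finrank_pos (by omega)
    rw [Module.natCard_eq_pow_finrank (K := Fq), h1, pow_one, Nat.card_eq_fintype_card]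
  rw [hA] at hcard
  set N := LinearMap.range (LinearMap.lsmul Fq[X] (TP Fq L) X) with hN
  let ψ : degreeLT L r → (TP Fq L ⧸ N) := fun v => N.mkQ (toTP Fq (v : L[X]))
  have hψ : Function.Injective ψ := by
    intro v w hvw
    have h1 : toTP Fq (v : L[X]) - toTP Fq (w : L[X]) ∈ N :=
      (Submodule.Quotient.eq N).mp hvw
    obtain ⟨h, hh⟩ := h1
    rw [LinearMap.lsmul_apply, hsmul, ← map_sub] at hh
    have hdeg : ((v : L[X]) - w).degree < r := mem_degreeLT.mp (Submodule.sub_mem _ v.2 w.2)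
    have hh' : tmul (Fintype.card Fq) ((toTP Fq).symm h) ((toTP Fq).symm (Φ X)) =
      (v : L[X]) - w := hh
    have hg0 : (toTP Fq).symm (Φ X) ≠ 0 := by rintro h; rw [h] at hΦ; simp at hΦ; omega
    by_contra hne
    have hvw0 : (v : L[X]) - w ≠ 0 := fun h => hne (Subtype.ext (sub_eq_zero.mp h))
    have hh0 : (toTP Fq).symm h ≠ 0 := by
      intro h0
      rw [h0, tmul_zero_l] at hh'
      exact hvw0 hh'.symm
    have := tmul_natDegree Fq hh0 hg0
    rw [hh', hΦ] at this
    rw [degree_eq_natDegree hvw0] at hdeg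
    have : ((v : L[X]) - w).natDegree < r := by exact_mod_cast hdeg
    omega
  have hq := q_pos Fq
  have hfin : Finite (TP Fq L ⧸ N) := Nat.finite_of_card_ne_zero (by
    rw [hcard]; exact (pow_pos hq _).ne')
  have h2 := Nat.card_le_card_of_injective ψ hψ
  have h3 : Nat.card (degreeLT L r) = Fintype.card Fq ^ (d * r) := by
    rw [Nat.card_congr (degreeLTEquiv L r).toEquiv, Nat.card_fun,
      Module.natCard_eq_pow_finrank (K := Fq), hdr, ← pow_mul, Nat.card_eq_fintype_card]
    simp
  rw [h3, hcard] at h2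
  exact (Nat.pow_le_pow_iff_right (Fintype.one_lt_card (α := Fq))).mp h2

end TPring

section EndRank

variable (Fq : Type*) {L : Type*} [Field Fq] [Fintype Fq] [CommRing L] [Algebra Fq L]

theorem endo_rank [IsDomain L] [Finite L] (hL : IsField L) (d : ℕ)
    (hd : ∀ l : L, l ^ Fintype.card Fq ^ d = l)
    (hd0 : 0 < d) (hdr : Module.finrank Fq L = d) (r : ℕ) (hr : 0 < r)
    {S : Type*} [CommRing S] [IsDomain S] [Algebra Fq[X] S] [FaithfulSMul Fq[X] S]
    (ι : S →+* TP Fq L) (hinj : Function.Injective ι)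
    (hΦ : ((toTP Fq).symm (ι (algebraMap Fq[X] S X))).natDegree = r)
    (hcent : ∀ c : TP Fq L,
      (∀ a : Fq[X], c * ι (algebraMap Fq[X] S a) = ι (algebraMap Fq[X] S a) * c) → ∃ z, ι z = c) :
    Module.Finite Fq[X] S ∧ Module.Free Fq[X] S ∧ r ≤ Module.finrank Fq[X] S := by
  let Φ : Fq[X] →+* TP Fq L := ι.comp (algebraMap Fq[X] S)
  have hΦinj : Function.Injective Φ := hinj.comp (FaithfulSMul.algebraMap_injective _ _)
  letI m1 : Module Fq[X] (TP Fq L) := rightMod Φ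
  letI m2 : Module S (TP Fq L) := rightMod ι
  have hs1 : ∀ (e : Fq[X]) (y : TP Fq L), e • y = y * Φ e := fun _ _ => rfl
  have hs2 : ∀ (e : S) (y : TP Fq L), e • y = y * ι e := fun _ _ => rfl
  haveI : IsScalarTower Fq[X] S (TP Fq L) := by
    refine ⟨fun a s y => ?_⟩
    rw [hs1, hs2, hs2, Algebra.smul_def, mul_comm, map_mul, ← mul_assoc]
    rfl
  haveI hf : Module.Finite Fq[X] (TP Fq L) := finite_TP Fq hL r hr Φ hΦ hs1
  haveI : Module.IsTorsionFree Fq[X] (TP Fq L) := by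
    rw [Module.isTorsionFree_iff_smul_eq_zero]
    intro a y h
    rw [hs1, mul_eq_zero] at h
    rcases h with h | h
    · exact Or.inr h
    · left; exact (map_eq_zero_iff _ hΦinj).mp h
  haveI : Module.Free Fq[X] (TP Fq L) := inferInstance
  have hrk := rank_TP Fq d r hdr Φ hr hΦ hs1
  let il : S →ₗ[Fq[X]] TP Fq L :=
    { toFun := ι
      map_add' := map_add ι
      map_smul' := fun a s => by
        rw [RingHom.id_apply, hs1, Algebra.smul_def, mul_comm, map_mul]; rfl }
  haveI hfS : Module.Finite Fq[X] S := Module.Finite.of_injective il hinj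
  haveI : Module.IsTorsionFree Fq[X] S := inferInstance
  haveI hfr : Module.Free Fq[X] S := inferInstance
  refine ⟨hfS, hfr, ?_⟩
  by_contra hlt
  push Not at hlt
  obtain ⟨y, hy⟩ := rank_aux (A := Fq[X]) (S := S) (M := TP Fq L) (d + 1) (by
    intro l hl
    calc l * Module.finrank Fq[X] S ≤ d * Module.finrank Fq[X] S :=
          Nat.mul_le_mul_right _ (by omega)
      _ < d * r := Nat.mul_lt_mul_of_pos_left hlt hd0
      _ ≤ _ := hrk)
  haveI : Module.Finite Fq L := Module.finite_of_finrank_pos (by omega)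
  have := density_TP Fq d hd hd0 hdr ι hs2 (fun c hc => hcent c fun a => hc _) y hy
  rw [Fintype.card_fin] at this
  nlinarith

end EndRank

theorem pow_natCard_aux {L : Type*} [CommRing L] [Finite L] (hL : IsField L) (l : L) :
    l ^ Nat.card L = l := by
  let _ := hL.toField
  have := Fintype.ofFinite L
  rw [Nat.card_eq_fintype_card]
  exact FiniteField.pow_card l

theorem finite_quotient_span_fin {Fq : Type*} [Field Fq] {n : Fq[X]} (hn : n ≠ 0) :
    Module.Finite Fq (Fq[X] ⧸ Ideal.span {n}) := by
  exact (AdjoinRoot.powerBasis hn).finite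


section Core

variable (Fq : Type*) {L : Type*} [Field Fq] [Fintype Fq] [CommRing L] [Algebra Fq L]

theorem order_div {K : Type*} [Field K] [Algebra (RatFunc Fq) K] [Algebra Fq[X] K]
    [IsScalarTower Fq[X] (RatFunc Fq) K] (EO : Subalgebra Fq[X] K) [Module.Finite Fq[X] EO]
    (n : Fq[X]) (hn : n ≠ 0) (a : Fq[X]) (h : EO) (hh : n • h = algebraMap Fq[X] EO a) :
    n ∣ a := by
  have hintg : IsIntegral Fq[X] (h : K) :=
    (Algebra.IsIntegral.isIntegral (R := Fq[X]) h).map (EO.val)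
  have h1 : algebraMap Fq[X] K n * (h : K) = algebraMap Fq[X] K a := by
    have := congrArg (fun z : EO => (z : K)) hh
    simpa [Algebra.smul_def] using this
  have hn' : algebraMap Fq[X] (RatFunc Fq) n ≠ 0 := by
    rw [Ne, map_eq_zero_iff _ (IsFractionRing.injective Fq[X] (RatFunc Fq))]; exact hn
  have h2 : (h : K) = algebraMap (RatFunc Fq) K
      (algebraMap Fq[X] (RatFunc Fq) a / algebraMap Fq[X] (RatFunc Fq) n) := by
    rw [map_div₀, ← IsScalarTower.algebraMap_apply, ← IsScalarTower.algebraMap_apply, ← h1,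
      mul_div_cancel_left₀]
    rw [IsScalarTower.algebraMap_apply Fq[X] (RatFunc Fq) K]
    simpa using hn'
  rw [h2, isIntegral_algebraMap_iff (algebraMap (RatFunc Fq) K).injective] at hintg
  obtain ⟨c, hc⟩ := IsIntegrallyClosed.isIntegral_iff.mp hintg
  refine ⟨c, ?_⟩
  apply IsFractionRing.injective Fq[X] (RatFunc Fq)
  rw [map_mul, hc, mul_div_cancel₀ _ hn']

theorem order_rank {K : Type*} [Field K] [Algebra (RatFunc Fq) K] [Algebra Fq[X] K]
    [IsScalarTower Fq[X] (RatFunc Fq) K] (EO : Subalgebra Fq[X] K) [Module.Finite Fq[X] EO]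
    [Module.Free Fq[X] EO] [Module.Finite (RatFunc Fq) K] :
    Module.finrank Fq[X] EO ≤ Module.finrank (RatFunc Fq) K := by
  let B := Module.finBasis Fq[X] EO
  have h1 : LinearIndependent Fq[X] (fun i => (B i : K)) :=
    B.linearIndependent.map' EO.val.toLinearMap (LinearMap.ker_eq_bot.mpr Subtype.val_injective)
  have h2 := (LinearIndependent.iff_fractionRing Fq[X] (RatFunc Fq)).mp h1
  simpa using h2.fintype_card_le_finrank

theorem core [IsDomain L] [Finite L] (hL : IsField L) (d : ℕ)
    (hd : ∀ l : L, l ^ Fintype.card Fq ^ d = l)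
    (hd0 : 0 < d) (hdr : Module.finrank Fq L = d)
    {Ω : Type*} [Field Ω] [Algebra L Ω] [Algebra Fq Ω] [IsAlgClosed Ω]
    (r : ℕ) (hr : 2 ≤ r)
    (φ : Fq[X] → L[X])
    (hadd : ∀ a b, φ (a + b) = φ a + φ b)
    (hmul : ∀ a b, φ (a * b) = tmul (Fintype.card Fq) (φ a) (φ b))
    (hone : φ 1 = 1)
    (hrank : ∀ a : Fq[X], a ≠ 0 → (φ a).natDegree = r * a.natDegree)
    (K : Type*) [Field K] [Algebra (RatFunc Fq) K] [Algebra Fq[X] K]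
    [IsScalarTower Fq[X] (RatFunc Fq) K]
    (hK : Module.finrank (RatFunc Fq) K = r)
    (j : L[X] → K)
    (E : Set L[X])
    (hE : E = {w | ∀ a : Fq[X],
      tmul (Fintype.card Fq) w (φ a) = tmul (Fintype.card Fq) (φ a) w})
    (hjadd : ∀ u ∈ E, ∀ v ∈ E, j (u + v) = j u + j v)
    (hjmul : ∀ u ∈ E, ∀ v ∈ E, j (tmul (Fintype.card Fq) u v) = j u * j v)
    (hjA : ∀ a : Fq[X], j (φ a) = algebraMap Fq[X] K a)
    (hjinj : Set.InjOn j E)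
    (π : K)
    (hπ : π = j ((X : L[X]) ^ d))
    (EO : Subalgebra Fq[X] K) (hEO : (EO : Set K) = j '' E)
    (b : Fin (r - 1) → Ideal Fq[X])
    (hbchain : ∀ i i' : Fin (r - 1), i ≤ i' → b i ∣ b i')
    (hiso : Nonempty
      (((Subalgebra.toSubmodule EO : Submodule Fq[X] K) ⧸
          (Subalgebra.toSubmodule
            (Algebra.adjoin Fq[X] ({π} : Set K))).comap
            (Subalgebra.toSubmodule EO).subtype) ≃ₗ[Fq[X]]
        ((i : Fin (r - 1)) → Fq[X] ⧸ b i)))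
    (n : Fq[X]) (hn : n ≠ 0) (hcop : (φ n).coeff 0 ≠ 0) :
    (∃ c : Fq[X], ∀ x : Ω,
        teval (Fintype.card Fq) (φ n) x = 0 →
          teval (Fintype.card Fq) ((X : L[X]) ^ d) x = teval (Fintype.card Fq) (φ c) x) ↔
      b ⟨0, by omega⟩ ≤ Ideal.span {n} := by
  have hmem : ∀ w, w ∈ E ↔ ∀ a, toTP Fq w * toTP Fq (φ a) = toTP Fq (φ a) * toTP Fq w := by
    intro w; rw [hE]; rfl
  -- closure properties
  have hEadd : ∀ u ∈ E, ∀ v ∈ E, u + v ∈ E := by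
    intro u hu v hv
    rw [hmem] at *
    intro a
    rw [map_add, add_mul, mul_add, hu, hv]
  have hEmul : ∀ u ∈ E, ∀ v ∈ E, tmul (Fintype.card Fq) u v ∈ E := by
    intro u hu v hv
    rw [hmem] at *
    intro a
    rw [toTP_tmul, mul_assoc, hv, ← mul_assoc, hu, mul_assoc]
  have hEφ : ∀ a, φ a ∈ E := by
    intro a
    rw [hmem]
    intro c
    rw [← toTP_tmul, ← toTP_tmul, ← hmul, ← hmul, mul_comm]
  have hX : (X : L[X]) ^ d = monomial d 1 := by simp [monomial_one_right_eq_X_pow]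
  have hEX : (X : L[X]) ^ d ∈ E := by
    rw [hmem]
    intro c
    have := frob_comm Fq d hd 1 (toTP Fq (φ c))
    rwa [mul_one, ← hX] at this
  have hAK : Function.Injective (algebraMap Fq[X] K) := by
    rw [IsScalarTower.algebraMap_eq Fq[X] (RatFunc Fq) K]
    exact (algebraMap (RatFunc Fq) K).injective.comp (IsFractionRing.injective _ _)
  -- the inverse of `j`
  have hex : ∀ z : EO, ∃ w ∈ E, j w = (z : K) := by
    intro z
    have : (z : K) ∈ (EO : Set K) := z.2
    rw [hEO] at this
    exact this
  choose i hiE hij using hex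
  have hjE : ∀ w ∈ E, j w ∈ EO := by
    intro w hw
    have : j w ∈ (EO : Set K) := by rw [hEO]; exact ⟨w, hw, rfl⟩
    exact this
  have hi_eq : ∀ (z : EO) (w), w ∈ E → j w = (z : K) → i z = w := by
    intro z w hw h
    exact hjinj (hiE z) hw (by rw [hij, h])
  have hiA : ∀ a, i (algebraMap Fq[X] EO a) = φ a := by
    intro a
    exact hi_eq _ _ (hEφ a) (by rw [hjA]; rfl)
  have hiadd : ∀ x y, i (x + y) = i x + i y := by
    intro x y
    apply hi_eq _ _ (hEadd _ (hiE x) _ (hiE y))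
    rw [hjadd _ (hiE x) _ (hiE y), hij, hij]; rfl
  have himul : ∀ x y, i (x * y) = tmul (Fintype.card Fq) (i x) (i y) := by
    intro x y
    apply hi_eq _ _ (hEmul _ (hiE x) _ (hiE y))
    rw [hjmul _ (hiE x) _ (hiE y), hij, hij]; rfl
  let ι : EO →+* TP Fq L := RingHom.mk' ⟨⟨fun z => toTP Fq (i z), by
      rw [← map_one (algebraMap Fq[X] EO), hiA, hone, toTP_one]⟩, fun x y => by
      change toTP Fq (i (x * y)) = _
      rw [himul, toTP_tmul]⟩ (fun x y => by
      change toTP Fq (i (x + y)) = _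
      rw [hiadd, map_add]; rfl)
  have hι : ∀ z, ι z = toTP Fq (i z) := fun _ => rfl
  have hιinj : Function.Injective ι := by
    intro x y hxy
    rw [hι, hι] at hxy
    have := (toTP Fq).injective hxy
    apply Subtype.ext
    rw [← hij, ← hij, this]
  haveI : FaithfulSMul Fq[X] EO := by
    rw [faithfulSMul_iff_algebraMap_injective]
    intro a c hac
    exact hAK (congrArg (fun z : EO => (z : K)) hac)
  obtain ⟨hfin, hfree, hrle⟩ := endo_rank Fq hL d hd hd0 hdr r (by omega) ι hιinj
    (by
      rw [hι, hiA, AddEquiv.symm_apply_apply, hrank _ X_ne_zero, natDegree_X, mul_one])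
    (by
      intro c hc
      have hcE : (toTP Fq).symm c ∈ E := by
        rw [hmem]
        intro a
        have := hc a
        rw [hι, hiA] at this
        simpa using this
      refine ⟨⟨j ((toTP Fq).symm c), hjE _ hcE⟩, ?_⟩
      rw [hι, hi_eq _ _ hcE rfl, AddEquiv.apply_symm_apply])
  haveI : Module.Finite (RatFunc Fq) K := Module.finite_of_finrank_pos (by omega)
  have hfr : Module.finrank Fq[X] EO = (r - 1) + 1 := by
    have := order_rank Fq EO
    omega
  haveI : Finite (Fq[X] ⧸ Ideal.span {n}) := by
    haveI : Module.Finite Fq (Fq[X] ⧸ Ideal.span {n}) :=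
      finite_quotient_span_fin hn
    exact Module.finite_of_finite Fq
  obtain ⟨e⟩ := hiso
  let P : Submodule Fq[X] EO := (Subalgebra.toSubmodule
            (Algebra.adjoin Fq[X] ({π} : Set K))).comap
            (Subalgebra.toSubmodule EO).subtype
  have hPmem : ∀ z : EO, z ∈ P ↔ (z : K) ∈ Algebra.adjoin Fq[X] ({π} : Set K) := fun _ => Iff.rfl
  have hP1 : (1 : Submodule Fq[X] EO) ≤ P := by
    intro z hz
    obtain ⟨a, rfl⟩ := Submodule.mem_one.mp hz
    rw [hPmem]
    exact Subalgebra.algebraMap_mem _ a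
  rw [← count_main (H := EO) n (fun a h => order_div Fq EO n hn a h) (r - 1) hfr b ⟨0, by omega⟩
    (fun i => Ideal.le_of_dvd (hbchain _ _ (Fin.mk_le_of_le_val (Nat.zero_le _)))) P hP1 e]
  have hπE : π ∈ EO := by rw [hπ]; exact hjE _ hEX
  let πO : EO := ⟨π, hπE⟩
  have hiπ : i πO = X ^ d := hi_eq _ _ hEX hπ.symm
  have hXmem : ∀ z : EO, z ∈ (1 : Submodule Fq[X] EO) ⊔
      LinearMap.range (LinearMap.lsmul Fq[X] EO n) ↔
      ∃ c h, z = algebraMap Fq[X] EO c + n • h := by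
    intro z
    rw [Submodule.mem_sup]
    constructor
    · rintro ⟨y, hy, w, ⟨h, rfl⟩, rfl⟩
      obtain ⟨c, rfl⟩ := Submodule.mem_one.mp hy
      exact ⟨c, h, rfl⟩
    · rintro ⟨c, h, rfl⟩
      exact ⟨_, Submodule.mem_one.mpr ⟨c, rfl⟩, _, ⟨h, rfl⟩, rfl⟩
  have hstep : P ≤ (1 : Submodule Fq[X] EO) ⊔ LinearMap.range (LinearMap.lsmul Fq[X] EO n) ↔
      ∃ c h, πO = algebraMap Fq[X] EO c + n • h := by
    rw [← hXmem]
    constructor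
    · intro h
      exact h ((hPmem _).mpr (Algebra.subset_adjoin rfl))
    · intro h z hz
      rw [hPmem] at hz
      rw [hXmem] at h ⊢
      obtain ⟨c, h, hc⟩ := h
      have hz' : ∃ (c : Fq[X]) (h : EO), (z : K) = ((algebraMap Fq[X] EO c + n • h : EO) : K) := by
        generalize (z : K) = w at hz
        induction hz using Algebra.adjoin_induction with
        | mem x hx =>
          rw [Set.mem_singleton_iff.mp hx]
          exact ⟨c, h, congrArg Subtype.val hc⟩
        | algebraMap a => exact ⟨a, 0, by simp⟩
        | add x y _ _ hx hy =>
          obtain ⟨c1, h1, rfl⟩ := hx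
          obtain ⟨c2, h2, rfl⟩ := hy
          refine ⟨c1 + c2, h1 + h2, ?_⟩
          rw [← EO.coe_add]
          congr 1
          rw [map_add, smul_add]; abel
        | mul x y _ _ hx hy =>
          obtain ⟨c1, h1, rfl⟩ := hx
          obtain ⟨c2, h2, rfl⟩ := hy
          refine ⟨c1 * c2, h1 * algebraMap _ _ c2 + algebraMap _ _ c1 * h2 + n • (h1 * h2), ?_⟩
          rw [← EO.coe_mul]
          congr 1
          simp only [Algebra.smul_def, map_mul]
          ring
      obtain ⟨c, h, hz'⟩ := hz'
      exact ⟨c, h, Subtype.ext hz'⟩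
  rw [hstep]
  constructor
  · rintro ⟨c, hc⟩
    obtain ⟨u, hu⟩ := tors_div (Ω := Ω) Fq hL (φ n) (X ^ d - φ c) hcop (by
      intro x hx
      have h1 := teval_add_l (Fintype.card Fq) (X ^ d - φ c) (φ c) x
      rw [sub_add_cancel, hc x hx] at h1
      exact left_eq_add.mp (h1.trans (add_comm _ _)))
    have hφn : toTP Fq (φ n) ≠ 0 := by
      intro h
      apply hcop
      have : φ n = 0 := (toTP Fq).map_eq_zero_iff.mp h
      rw [this, coeff_zero]
    have huT : toTP Fq (X ^ d) = toTP Fq (φ c) + toTP Fq u * toTP Fq (φ n) := by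
      rw [← toTP_tmul, ← hu, ← map_add, add_sub_cancel]
    have huE : u ∈ E := by
      rw [hmem]
      intro a
      apply mul_right_cancel₀ hφn
      have h1 := (hmem _).mp hEX a
      have h2 := (hmem _).mp (hEφ c) a
      have h3 := (hmem _).mp (hEφ n) a
      rw [huT, add_mul, mul_add, h2, add_right_inj] at h1
      rw [mul_assoc, ← h3, ← mul_assoc, h1, mul_assoc]
    refine ⟨c, ⟨j u, hjE u huE⟩, ?_⟩
    apply hιinj
    rw [map_add, Algebra.smul_def, mul_comm, map_mul, hι, hι, hι, hι, hiπ, hiA, hiA,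
      hi_eq _ _ huE rfl, huT]
  · rintro ⟨c, h, hc⟩
    have h1 := congrArg ι hc
    rw [map_add, Algebra.smul_def, mul_comm, map_mul, hι, hι, hι, hι, hiπ, hiA, hiA,
      ← toTP_tmul, ← map_add] at h1
    have h2 := (toTP Fq).injective h1
    refine ⟨c, fun x hx => ?_⟩
    rw [h2, teval_add_l, teval_tmul, hx, teval_zero_r, add_zero]

end Core

/-- Let `φ` be a Drinfeld `A`-module of rank `r` over `F_p` with Frobenius
`π = τ^d ∈ E = End_{F_p}(φ)`.  Identify `E` with an `A`-order `EO` in a degree-`r` field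
extension `K` of `F = F_q(T)` via `j`, sending `τ^d` to `π` and `φ_a` to `a`.  If
`(b₁, …, b_{r-1})`, `b₁ ∣ ⋯ ∣ b_{r-1}`, is the refined index of `A[π] ⊆ EO` and `n ∈ A` is
nonzero and coprime to `p`, then `π` acts as a scalar `φ_c` on the `n`-torsion `φ[n]` if and
only if `n` divides `b₁`. -/
theorem stmt6 (Fq : Type*) [Field Fq] [Fintype Fq]
    (p : Polynomial Fq) (hp : Irreducible p) [hmax : (Ideal.span {p}).IsMaximal]
    (Ω : Type*) [Field Ω] [Algebra (Polynomial Fq ⧸ Ideal.span {p}) Ω]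
    [IsAlgClosed Ω] [Algebra.IsAlgebraic (Polynomial Fq ⧸ Ideal.span {p}) Ω]
    (r : ℕ) (hr : 2 ≤ r)
    (φ : Polynomial Fq → Polynomial (Polynomial Fq ⧸ Ideal.span {p}))
    (hadd : ∀ a b, φ (a + b) = φ a + φ b)
    (hmul : ∀ a b, φ (a * b) = tmul (Fintype.card Fq) (φ a) (φ b))
    (hone : φ 1 = 1)
    (hrank : ∀ a : Polynomial Fq, a ≠ 0 → (φ a).natDegree = r * a.natDegree)
    (hconst : ∀ a : Polynomial Fq, (φ a).coeff 0 = Ideal.Quotient.mk (Ideal.span {p}) a)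
    -- the field `K = F(π)` of degree `r` over `F`
    (K : Type*) [Field K] [Algebra (RatFunc Fq) K] [Algebra (Polynomial Fq) K]
    [IsScalarTower (Polynomial Fq) (RatFunc Fq) K]
    (hK : Module.finrank (RatFunc Fq) K = r)
    -- the identification `j` of the endomorphism ring `E` (centralizer of `φ(A)` in
    -- `F_p{τ}`) with an `A`-order `EO ⊆ K`
    (j : Polynomial (Polynomial Fq ⧸ Ideal.span {p}) → K)
    (E : Set (Polynomial (Polynomial Fq ⧸ Ideal.span {p})))
    (hE : E = {w | ∀ a : Polynomial Fq,
      tmul (Fintype.card Fq) w (φ a) = tmul (Fintype.card Fq) (φ a) w})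
    (hjadd : ∀ u ∈ E, ∀ v ∈ E, j (u + v) = j u + j v)
    (hjmul : ∀ u ∈ E, ∀ v ∈ E, j (tmul (Fintype.card Fq) u v) = j u * j v)
    (hjA : ∀ a : Polynomial Fq, j (φ a) = algebraMap (Polynomial Fq) K a)
    (hjinj : Set.InjOn j E)
    (π : K)
    (hπ : π = j ((Polynomial.X :
      Polynomial (Polynomial Fq ⧸ Ideal.span {p})) ^ p.natDegree))
    (EO : Subalgebra (Polynomial Fq) K) (hEO : (EO : Set K) = j '' E)
    -- the refined index of `A[π] ⊆ EO`
    (b : Fin (r - 1) → Ideal (Polynomial Fq))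
    (hb0 : ∀ i, b i ≠ ⊥) (hbchain : ∀ i i' : Fin (r - 1), i ≤ i' → b i ∣ b i')
    (hiso : Nonempty
      (((Subalgebra.toSubmodule EO : Submodule (Polynomial Fq) K) ⧸
          (Subalgebra.toSubmodule
            (Algebra.adjoin (Polynomial Fq) ({π} : Set K))).comap
            (Subalgebra.toSubmodule EO).subtype) ≃ₗ[Polynomial Fq]
        ((i : Fin (r - 1)) → Polynomial Fq ⧸ b i)))
    (n : Polynomial Fq) (hn : n ≠ 0) (hcop : IsCoprime n p) :
    (∃ c : Polynomial Fq, ∀ x : Ω,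
        teval (Fintype.card Fq) (φ n) x = 0 →
          teval (Fintype.card Fq)
            ((Polynomial.X : Polynomial (Polynomial Fq ⧸ Ideal.span {p})) ^ p.natDegree) x =
            teval (Fintype.card Fq) (φ c) x) ↔
      b ⟨0, by omega⟩ ≤ Ideal.span {n} := by
  have hp0 : p ≠ 0 := hp.ne_zero
  have hd0 : 0 < p.natDegree := hp.natDegree_pos
  have hL : IsField (Polynomial Fq ⧸ Ideal.span {p}) :=
    (Ideal.Quotient.maximal_ideal_iff_isField_quotient _).mp hmax
  have hdom : IsDomain (Polynomial Fq ⧸ Ideal.span {p}) := hL.isDomain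
  have hdr : Module.finrank Fq (Polynomial Fq ⧸ Ideal.span {p}) = p.natDegree :=
    finrank_quotient_span_eq_natDegree
  have hmf : Module.Finite Fq (Polynomial Fq ⧸ Ideal.span {p}) := finite_quotient_span_fin hp0
  have hfin : Finite (Polynomial Fq ⧸ Ideal.span {p}) := Module.finite_of_finite Fq
  have hd : ∀ l : Polynomial Fq ⧸ Ideal.span {p},
      l ^ Fintype.card Fq ^ p.natDegree = l := by
    have hc : Nat.card (Polynomial Fq ⧸ Ideal.span {p}) = Fintype.card Fq ^ p.natDegree := by
      rw [Module.natCard_eq_pow_finrank (K := Fq), hdr, Nat.card_eq_fintype_card]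
    intro l
    rw [← hc]
    exact pow_natCard_aux hL l
  let _ : Algebra Fq Ω :=
    ((algebraMap (Polynomial Fq ⧸ Ideal.span {p}) Ω).comp
      (algebraMap Fq (Polynomial Fq ⧸ Ideal.span {p}))).toAlgebra
  refine core Fq hL p.natDegree hd hd0 hdr r hr φ hadd hmul hone hrank K hK j E hE hjadd hjmul
    hjA hjinj π hπ EO hEO b hbchain hiso n hn ?_
  rw [hconst, Ne, Ideal.Quotient.eq_zero_iff_mem, Ideal.mem_span_singleton]
  intro hdvd
  exact hp.not_isUnit (hcop.isUnit_of_dvd' hdvd dvd_rfl)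
end
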